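/- Let ξ₀, ξ₁₂ : ℂ → ℂ be holomorphic with no common zero and let J be the warped product structure on ℝ⁶ determined by (ξ₀, ξ₁₂). For x ∈ ℝ⁶ set ω_{ab}(x) = ⟨J(x)e_a, e_b⟩. Suppose J is (globally) conformally Kähler: there exists a positive C¹ function λ : ℝ⁶ → ℝ such that for all indices a,b,c ∈ {1,…,6}, ∂_a(λ·ω_{bc}) + ∂_b(λ·ω_{ca}) + ∂_c(λ·ω_{ab}) = 0 identically on ℝ⁶ (i.e. d(λω) = 0). Then J is constant on ℝ⁶. -/

import Mathlib

open Matrix Filter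

attribute [local instance] Matrix.normedAddCommGroup Matrix.normedSpace

/-- The warped product almost complex structure on `ℝ⁶ = ℂ³` (real coordinates ordered
`(x₁,y₁,x₂,y₂,x₃,y₃)`) determined by `(ξ₀, ξ₁₂)`: block diagonal `J₁(z₃) ⊕ J₀`. -/
noncomputable def wpsJ (ξ₀ ξ₁₂ : ℂ → ℂ) (x : Fin 6 → ℝ) : Matrix (Fin 6) (Fin 6) ℝ :=
  let z : ℂ := (x 4 : ℂ) + (x 5 : ℂ) * Complex.I
  let a : ℝ := Complex.normSq (ξ₀ z)
  let b : ℝ := Complex.normSq (ξ₁₂ z)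
  let f : ℝ := ((starRingEnd ℂ) (ξ₀ z) * ξ₁₂ z).re
  let g : ℝ := ((starRingEnd ℂ) (ξ₀ z) * ξ₁₂ z).im
  (a + b)⁻¹ • !![0, b - a, -(2*g), 2*f, 0, 0;
                 a - b, 0, 2*f, 2*g, 0, 0;
                 2*g, -(2*f), 0, b - a, 0, 0;
                 -(2*f), -(2*g), a - b, 0, 0, 0;
                 0, 0, 0, 0, 0, -(a + b);
                 0, 0, 0, 0, a + b, 0]

/-- The Kähler form of `J` with respect to the Euclidean metric:
`ω_{ab}(x) = ⟨J(x)e_a, e_b⟩`. -/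
noncomputable def omegaJ (ξ₀ ξ₁₂ : ℂ → ℂ) (x : Fin 6 → ℝ) (a b : Fin 6) : ℝ :=
  (wpsJ ξ₀ ξ₁₂ x).mulVec (Pi.single a 1) ⬝ᵥ Pi.single b 1

/-- Partial derivative in the `a`-th real coordinate direction. -/
noncomputable def pderiv6 (a : Fin 6) (h : (Fin 6 → ℝ) → ℝ) (x : Fin 6 → ℝ) : ℝ :=
  fderiv ℝ h x (Pi.single a 1)

lemma omegaJ_eq_entry (ξ₀ ξ₁₂ : ℂ → ℂ) (x : Fin 6 → ℝ) (a b : Fin 6) :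
    omegaJ ξ₀ ξ₁₂ x a b = wpsJ ξ₀ ξ₁₂ x b a := by
  simp [omegaJ]

/-- `|z|² + |w|²` is nonzero unless both `z` and `w` vanish. -/
lemma normSq_add_normSq_ne_zero {z w : ℂ} (h : ¬(z = 0 ∧ w = 0)) :
    Complex.normSq z + Complex.normSq w ≠ 0 := fun hs =>
  h ⟨Complex.normSq_eq_zero.1 (by linarith [Complex.normSq_nonneg z, Complex.normSq_nonneg w]),
    Complex.normSq_eq_zero.1 (by linarith [Complex.normSq_nonneg z, Complex.normSq_nonneg w])⟩

/-- A warped product structure is determined by its first row. -/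
lemma wpsJ_eq_of_first_row {ξ₀ ξ₁₂ : ℂ → ℂ} (hnz : ∀ z : ℂ, ¬(ξ₀ z = 0 ∧ ξ₁₂ z = 0))
    (x : Fin 6 → ℝ) :
    wpsJ ξ₀ ξ₁₂ x =
      !![0, wpsJ ξ₀ ξ₁₂ x 0 1, wpsJ ξ₀ ξ₁₂ x 0 2, wpsJ ξ₀ ξ₁₂ x 0 3, 0, 0;
         -wpsJ ξ₀ ξ₁₂ x 0 1, 0, wpsJ ξ₀ ξ₁₂ x 0 3, -wpsJ ξ₀ ξ₁₂ x 0 2, 0, 0;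
         -wpsJ ξ₀ ξ₁₂ x 0 2, -wpsJ ξ₀ ξ₁₂ x 0 3, 0, wpsJ ξ₀ ξ₁₂ x 0 1, 0, 0;
         -wpsJ ξ₀ ξ₁₂ x 0 3, wpsJ ξ₀ ξ₁₂ x 0 2, -wpsJ ξ₀ ξ₁₂ x 0 1, 0, 0, 0;
         0, 0, 0, 0, 0, -1;
         0, 0, 0, 0, 1, 0] := by
  have hρ := normSq_add_normSq_ne_zero (hnz ((x 4 : ℂ) + (x 5 : ℂ) * Complex.I))
  ext i j
  fin_cases i <;> fin_cases j <;> simp [wpsJ, hρ, -neg_add_rev] <;> ring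

/-- The first row of a warped product structure is a unit vector. -/
lemma wpsJ_first_row_sq {ξ₀ ξ₁₂ : ℂ → ℂ} (hnz : ∀ z : ℂ, ¬(ξ₀ z = 0 ∧ ξ₁₂ z = 0))
    (x : Fin 6 → ℝ) :
    wpsJ ξ₀ ξ₁₂ x 0 1 ^ 2 + wpsJ ξ₀ ξ₁₂ x 0 2 ^ 2 + wpsJ ξ₀ ξ₁₂ x 0 3 ^ 2 = 1 := by
  have hρ := normSq_add_normSq_ne_zero (hnz ((x 4 : ℂ) + (x 5 : ℂ) * Complex.I))
  simp only [wpsJ, Matrix.smul_apply, smul_eq_mul, Matrix.of_apply, Matrix.cons_val]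
  field_simp
  simp only [Complex.normSq_apply, Complex.mul_re, Complex.mul_im, Complex.conj_re,
    Complex.conj_im]
  ring

lemma differentiable_wpsJ_first_row {ξ₀ ξ₁₂ : ℂ → ℂ} (h₀ : Differentiable ℂ ξ₀)
    (h₁₂ : Differentiable ℂ ξ₁₂) (hnz : ∀ z : ℂ, ¬(ξ₀ z = 0 ∧ ξ₁₂ z = 0)) (i : Fin 6) :
    Differentiable ℝ (fun x => wpsJ ξ₀ ξ₁₂ x 0 i) := by
  have hz : Differentiable ℝ (fun x : Fin 6 → ℝ => (x 4 : ℂ) + (x 5 : ℂ) * Complex.I) :=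
    (Complex.ofRealCLM.differentiable.comp (differentiable_apply 4)).add
      ((Complex.ofRealCLM.differentiable.comp (differentiable_apply 5)).mul_const _)
  have hre {F : ℂ → ℂ} (hF : Differentiable ℂ F) :
      Differentiable ℝ (fun x : Fin 6 → ℝ => (F (x 4 + x 5 * Complex.I)).re) :=
    Complex.reCLM.differentiable.comp ((hF.restrictScalars ℝ).comp hz)
  have him {F : ℂ → ℂ} (hF : Differentiable ℂ F) :
      Differentiable ℝ (fun x : Fin 6 → ℝ => (F (x 4 + x 5 * Complex.I)).im) :=
    Complex.imCLM.differentiable.comp ((hF.restrictScalars ℝ).comp hz)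
  have r₀ := hre h₀
  have i₀ := him h₀
  have r₁ := hre h₁₂
  have i₁ := him h₁₂
  have hρ (x : Fin 6 → ℝ) := normSq_add_normSq_ne_zero (hnz ((x 4 : ℂ) + (x 5 : ℂ) * Complex.I))
  simp only [Complex.normSq_apply] at hρ
  fin_cases i <;>
    simp only [wpsJ, Matrix.smul_apply, smul_eq_mul, Matrix.of_apply, Matrix.cons_val,
      Complex.normSq_apply, Complex.mul_re, Complex.mul_im, Complex.conj_re, Complex.conj_im,
      Fin.zero_eta, Fin.mk_one, Fin.reduceFinMk] <;>
    fun_prop (disch := assumption)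

/-- The inclusion of the `z₃`-axis in `ℝ⁶ = ℂ³`. -/
noncomputable def thirdAxis : ℂ →L[ℝ] (Fin 6 → ℝ) :=
  Complex.reCLM.smulRight (Pi.single 4 1) + Complex.imCLM.smulRight (Pi.single 5 1)

lemma wpsJ_thirdAxis (ξ₀ ξ₁₂ : ℂ → ℂ) (x : Fin 6 → ℝ) :
    wpsJ ξ₀ ξ₁₂ (thirdAxis ⟨x 4, x 5⟩) = wpsJ ξ₀ ξ₁₂ x := by
  simp [wpsJ, thirdAxis]

/-- A differentiable function whose partial derivatives in `x₃` and `y₃` vanish is constant along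
the `z₃`-axis. -/
lemma eq_on_thirdAxis {h : (Fin 6 → ℝ) → ℝ} (hd : Differentiable ℝ h)
    (h4 : ∀ x, pderiv6 4 h x = 0) (h5 : ∀ x, pderiv6 5 h x = 0) (z w : ℂ) :
    h (thirdAxis z) = h (thirdAxis w) := by
  refine is_const_of_fderiv_eq_zero (𝕜 := ℝ) (f := h ∘ thirdAxis)
    (hd.comp thirdAxis.differentiable) (fun u => ?_) z w
  rw [fderiv_comp u (hd _) thirdAxis.differentiableAt, ContinuousLinearMap.fderiv]
  ext v
  have e4 := h4 (thirdAxis u)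
  have e5 := h5 (thirdAxis u)
  simp only [pderiv6] at e4 e5
  simp [thirdAxis] at e4 e5 ⊢
  simp [e4, e5]

/-- If a warped product orthogonal complex structure on `ℝ⁶` is globally conformally
Kähler — there is a positive `C¹` function `λ` with `d(λω) = 0` — then it is constant. -/
theorem warped_product_conformally_Kahler_is_constant (ξ₀ ξ₁₂ : ℂ → ℂ)
    (h₀ : Differentiable ℂ ξ₀) (h₁₂ : Differentiable ℂ ξ₁₂)
    (hnz : ∀ z : ℂ, ¬(ξ₀ z = 0 ∧ ξ₁₂ z = 0))
    (lam : (Fin 6 → ℝ) → ℝ) (hlamC1 : ContDiff ℝ 1 lam) (hlampos : ∀ x, 0 < lam x)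
    (hclosed : ∀ (a b c : Fin 6) (x : Fin 6 → ℝ),
      pderiv6 a (fun y => lam y * omegaJ ξ₀ ξ₁₂ y b c) x
        + pderiv6 b (fun y => lam y * omegaJ ξ₀ ξ₁₂ y c a) x
        + pderiv6 c (fun y => lam y * omegaJ ξ₀ ξ₁₂ y a b) x = 0) :
    ∀ x y : Fin 6 → ℝ, wpsJ ξ₀ ξ₁₂ x = wpsJ ξ₀ ξ₁₂ y := by
  have hconst (i : Fin 6) (hi : i = 1 ∨ i = 2 ∨ i = 3) (z w : ℂ) :
      lam (thirdAxis z) * wpsJ ξ₀ ξ₁₂ (thirdAxis z) 0 i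
        = lam (thirdAxis w) * wpsJ ξ₀ ξ₁₂ (thirdAxis w) 0 i := by
    have hpd (c : Fin 6) (hc : c = 4 ∨ c = 5) (x : Fin 6 → ℝ) :
        pderiv6 c (fun y => lam y * wpsJ ξ₀ ξ₁₂ y 0 i) x = 0 := by
      have h := hclosed c i 0 x
      simp only [omegaJ_eq_entry] at h
      have v₁ (y : Fin 6 → ℝ) : wpsJ ξ₀ ξ₁₂ y c 0 = 0 := by
        rcases hc with rfl | rfl <;> simp [wpsJ]
      have v₂ (y : Fin 6 → ℝ) : wpsJ ξ₀ ξ₁₂ y i c = 0 := by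
        rcases hc with rfl | rfl <;> rcases hi with rfl | rfl | rfl <;> simp [wpsJ]
      simpa [v₁, v₂, pderiv6] using h
    exact eq_on_thirdAxis ((hlamC1.differentiable one_ne_zero).mul
      (differentiable_wpsJ_first_row h₀ h₁₂ hnz i)) (hpd 4 (.inl rfl)) (hpd 5 (.inr rfl)) z w
  intro x y
  rw [← wpsJ_thirdAxis ξ₀ ξ₁₂ x, ← wpsJ_thirdAxis ξ₀ ξ₁₂ y]
  generalize (⟨x 4, x 5⟩ : ℂ) = z
  generalize (⟨y 4, y 5⟩ : ℂ) = w
  have e₁ := hconst 1 (by simp) z w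
  have e₂ := hconst 2 (by simp) z w
  have e₃ := hconst 3 (by simp) z w
  have hlam : lam (thirdAxis z) = lam (thirdAxis w) := by
    rw [← sq_eq_sq₀ (hlampos _).le (hlampos _).le]
    have hsq (u : ℂ) : lam (thirdAxis u) ^ 2 =
        (lam (thirdAxis u) * wpsJ ξ₀ ξ₁₂ (thirdAxis u) 0 1) ^ 2
          + (lam (thirdAxis u) * wpsJ ξ₀ ξ₁₂ (thirdAxis u) 0 2) ^ 2
          + (lam (thirdAxis u) * wpsJ ξ₀ ξ₁₂ (thirdAxis u) 0 3) ^ 2 := by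
      linear_combination -lam (thirdAxis u) ^ 2 * wpsJ_first_row_sq hnz (thirdAxis u)
    rw [hsq z, hsq w, e₁, e₂, e₃]
  rw [hlam] at e₁ e₂ e₃
  have hne := (hlampos (thirdAxis w)).ne'
  rw [wpsJ_eq_of_first_row hnz (thirdAxis z), wpsJ_eq_of_first_row hnz (thirdAxis w),
    mul_left_cancel₀ hne e₁, mul_left_cancel₀ hne e₂, mul_left_cancel₀ hne e₃]
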